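/- arXiv:1003.0197 — 7 statements merged into one kernel-verified Lean document; each statement's English description precedes it below -/
import Mathlib

section
/- Let R be an integral domain and let f, g : ℤ × V → R be two R-friezes on the repetition quiver ℤQ of a finite acyclic quiver Q, all of whose values are nonzero. Let s : V → ℤ be a function such that s(i) − s(j) ∈ {0, 1} whenever E i j > 0 (so that the points (s(i), i), i ∈ V, form a section of ℤQ). If f(s(i), i) = g(s(i), i) for every i ∈ V, then f(n, i) = g(n, i) for all n ∈ ℤ and i ∈ V. (That is, a frieze on ℤQ with nonzero values in an integral domain is entirely determined by its values on a section.) -/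
/-- `E i j` is the number of arrows `i → j`.  The quiver is acyclic: there is no
sequence `i₀, …, i_k` with `k ≥ 1`, `i₀ = i_k` and an arrow `i_m → i_{m+1}` for all
`m < k`. -/
def IsAcyclic {V : Type*} (E : V → V → ℕ) : Prop :=
  ∀ (k : ℕ) (c : ℕ → V), 1 ≤ k → c 0 = c k → ∃ m < k, E (c m) (c (m + 1)) = 0

/-- An `R`-frieze on the repetition quiver `ℤQ` of the quiver with arrow
multiplicities `E`. -/
def IsFriezeZQ {V : Type*} [Fintype V] {R : Type*} [CommRing R]
    (E : V → V → ℕ) (f : ℤ × V → R) : Prop :=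
  ∀ (n : ℤ) (i : V),
    f (n, i) * f (n - 1, i) =
      (∏ k, f (n, k) ^ E k i) * (∏ j, f (n - 1, j) ^ E i j) + 1

theorem chain_of_transGen {V : Type*} (E : V → V → ℕ) {a b : V}
    (h : Relation.TransGen (fun i j => 0 < E i j) a b) :
    ∃ (k : ℕ) (c : ℕ → V), 1 ≤ k ∧ c 0 = a ∧ c k = b ∧ ∀ m < k, 0 < E (c m) (c (m + 1)) := by
  induction h with
  | single h =>
    rename_i b
    refine ⟨1, fun n => if n = 0 then a else b, le_rfl, by simp, by simp, ?_⟩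
    intro m hm
    have : m = 0 := by omega
    subst this
    simpa using h
  | tail _ h ih =>
    rename_i b' d _
    obtain ⟨k, c, hk, h0, hkb, hc⟩ := ih
    refine ⟨k + 1, fun n => if n ≤ k then c n else d, by omega, by simpa using h0, by simp, ?_⟩
    intro m hm
    rcases Nat.lt_or_ge m k with h1 | h1
    · have h2 : m ≤ k := h1.le
      have h3 : m + 1 ≤ k := h1
      simpa only [h2, h3, if_true] using hc m h1
    · have : m = k := by omega
      subst this
      simpa [hkb] using h

theorem transGen_irrefl {V : Type*} (E : V → V → ℕ) (hac : IsAcyclic E) (a : V) :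
    ¬ Relation.TransGen (fun i j => 0 < E i j) a a := by
  intro h
  obtain ⟨k, c, hk, h0, hkb, hc⟩ := chain_of_transGen E h
  obtain ⟨m, hm, h⟩ := hac k c hk (h0.trans hkb.symm)
  have := hc m hm
  omega

theorem wf_arrow {V : Type*} [Finite V] (E : V → V → ℕ) (hac : IsAcyclic E) :
    WellFounded (fun i j => 0 < E i j) ∧ WellFounded (fun i j => 0 < E j i) := by
  constructor
  · have : Std.Irrefl (Relation.TransGen (fun i j => 0 < E i j)) := ⟨transGen_irrefl E hac⟩
    refine Subrelation.wf (fun h => ?_)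
      (Finite.wellFounded_of_trans_of_irrefl (Relation.TransGen (fun i j => 0 < E i j)))
    exact Relation.TransGen.single h
  · have : Std.Irrefl (Function.swap (Relation.TransGen (fun i j => 0 < E i j))) :=
      ⟨transGen_irrefl E hac⟩
    have : IsTrans V (Function.swap (Relation.TransGen (fun i j => 0 < E i j))) :=
      ⟨fun _ _ _ h1 h2 => Relation.TransGen.trans h2 h1⟩
    refine Subrelation.wf (fun h => ?_)
      (Finite.wellFounded_of_trans_of_irrefl
        (Function.swap (Relation.TransGen (fun i j => 0 < E i j))))
    exact Relation.TransGen.single (r := fun i j => 0 < E i j) h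

theorem frieze_rhs_eq {V R : Type*} [Fintype V] [CommRing R]
    (E : V → V → ℕ) (f g : ℤ × V → R) (hf : IsFriezeZQ E f) (hg : IsFriezeZQ E g)
    (n : ℤ) (i : V) (h1 : ∀ k, 0 < E k i → f (n, k) = g (n, k))
    (h2 : ∀ j, 0 < E i j → f (n - 1, j) = g (n - 1, j)) :
    f (n, i) * f (n - 1, i) = g (n, i) * g (n - 1, i) := by
  rw [hf, hg]
  congr 2
  · refine Finset.prod_congr rfl fun k _ => ?_
    rcases Nat.eq_zero_or_pos (E k i) with h | h
    · simp [h]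
    · rw [h1 k h]
  · refine Finset.prod_congr rfl fun k _ => ?_
    rcases Nat.eq_zero_or_pos (E i k) with h | h
    · simp [h]
    · rw [h2 k h]

/-- A frieze with nonzero values in an integral domain on `ℤQ` is entirely
determined by its values on a section. -/
theorem frieze_eq_of_eq_on_section {V R : Type*} [Fintype V] [CommRing R] [IsDomain R]
    (E : V → V → ℕ) (hac : IsAcyclic E)
    (f g : ℤ × V → R) (hf : IsFriezeZQ E f) (hg : IsFriezeZQ E g)
    (hfnz : ∀ x, f x ≠ 0) (hgnz : ∀ x, g x ≠ 0)
    (s : V → ℤ) (hs : ∀ i j, 0 < E i j → s i - s j = 0 ∨ s i - s j = 1)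
    (hagree : ∀ i, f (s i, i) = g (s i, i)) :
    ∀ (n : ℤ) (i : V), f (n, i) = g (n, i) := by
  obtain ⟨wf1, wf2⟩ := wf_arrow E hac
  obtain ⟨N, hN⟩ := (Set.finite_range s).bddBelow
  obtain ⟨M, hM⟩ := (Set.finite_range s).bddAbove
  replace hN : ∀ i, N ≤ s i := fun i => hN ⟨i, rfl⟩
  replace hM : ∀ i, s i ≤ M := fun i => hM ⟨i, rfl⟩
  have up : ∀ (t : ℕ) (n : ℤ) (i : V), n = N + t → s i ≤ n → f (n, i) = g (n, i) := by
    intro t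
    induction t with
    | zero =>
      intro n i hn hi
      have := hN i
      have : n = s i := by push_cast at hn; omega
      rw [this]; exact hagree i
    | succ t ih =>
      intro n i hn
      induction i using wf1.induction with
      | _ i ihi =>
      intro hi
      rcases eq_or_lt_of_le hi with h | h
      · rw [← h]; exact hagree i
      have e := frieze_rhs_eq E f g hf hg n i
        (fun k hk => ihi k hk (by have := hs k i hk; omega))
        (fun j hj => ih (n - 1) j (by push_cast at hn; omega) (by have := hs i j hj; omega))
      rw [ih (n - 1) i (by push_cast at hn; omega) (by omega)] at e
      exact mul_right_cancel₀ (hgnz _) e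
  have down : ∀ (t : ℕ) (n : ℤ) (i : V), n = M - t → n ≤ s i → f (n, i) = g (n, i) := by
    intro t
    induction t with
    | zero =>
      intro n i hn hi
      have := hM i
      have : n = s i := by push_cast at hn; omega
      rw [this]; exact hagree i
    | succ t ih =>
      intro n i hn
      induction i using wf2.induction with
      | _ i ihi =>
      intro hi
      rcases eq_or_lt_of_le hi with h | h
      · rw [h]; exact hagree i
      have hn1 : n + 1 - 1 = n := by ring
      have e := frieze_rhs_eq E f g hf hg (n + 1) i
        (fun k hk => ih (n + 1) k (by push_cast at hn; omega) (by have := hs k i hk; omega))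
        (fun j hj => by
          rw [hn1]; exact ihi j hj (by have := hs i j hj; omega))
      rw [hn1, ih (n + 1) i (by push_cast at hn; omega) (by omega)] at e
      exact mul_left_cancel₀ (hgnz _) e
  intro n i
  have := hN i
  have := hM i
  rcases le_total (s i) n with h | h
  · exact up (n - N).toNat n i (by omega) h
  · exact down (M - n).toNat n i (by omega) h
end

section
/- Let R be an integral domain, p ≥ 1 an integer, and g an R-frieze on the tube of rank p all of whose values are nonzero. Then for every i ∈ ℤ/pℤ and every n ≥ 1, g(i, n) = P_n(g(i,1), g(i+1,1), …, g(i+n−1,1)), where P_n is the n-th generalised Chebyshev polynomial evaluated at the mouth values g(i,1), …, g(i+n−1,1) (indices taken in ℤ/pℤ). -/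
/-- An `R`-frieze on the tube of rank `p` : a function `g : (ℤ/pℤ) × ℕ → R` with
`g(i,0) = 1` and the mesh relation `g(i,n)·g(i−1,n) = g(i,n−1)·g(i−1,n+1) + 1`
for all `n ≥ 1` (stated here with `n` shifted by one). -/
def IsTubeFrieze {R : Type*} [CommRing R] (p : ℕ) (g : ZMod p × ℕ → R) : Prop :=
  (∀ i : ZMod p, g (i, 0) = 1) ∧
    ∀ (i : ZMod p) (n : ℕ),
      g (i, n + 1) * g (i - 1, n + 1) = g (i, n) * g (i - 1, n + 2) + 1

/-- The generalised Chebyshev polynomials: `P 0 = 1`, `P 1 (t) = t 0` and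
`P (n+2) (t) = t (n+1) * P (n+1) (t) - P n (t)` (so `P_{n+1}(t_0,…,t_n) =
t_n P_n(t_0,…,t_{n-1}) − P_{n-1}(t_0,…,t_{n-2})`, with `P_{-1} = 0`). -/
def chebP {R : Type*} [CommRing R] : ℕ → (ℕ → R) → R
  | 0, _ => 1
  | 1, t => t 0
  | (n + 2), t => t (n + 1) * chebP (n + 1) t - chebP n t

theorem tubeFrieze_rec {R : Type*} [CommRing R] [IsDomain R]
    (p : ℕ) (g : ZMod p × ℕ → R)
    (hg : IsTubeFrieze p g) (hnz : ∀ x, g x ≠ 0) (n : ℕ) :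
    ∀ i : ZMod p, g (i, n + 2) =
      g (i + ((n + 1 : ℕ) : ZMod p), 1) * g (i, n + 1) - g (i, n) := by
  obtain ⟨h0, h1⟩ := hg
  have hm : ∀ (i : ZMod p) (n : ℕ),
      g (i + 1, n + 1) * g (i, n + 1) = g (i + 1, n) * g (i, n + 2) + 1 := by
    intro i n
    have h := h1 (i + 1) n
    rwa [add_sub_cancel_right] at h
  induction n with
  | zero =>
    intro i
    have h := hm i 0
    simp only [zero_add, h0, one_mul, Nat.cast_one] at h ⊢
    rw [h]; ring
  | succ n ih =>
    intro i
    have a := hm i n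
    have b := hm i (n + 1)
    have c := ih (i + 1)
    have e : i + 1 + ((n + 1 : ℕ) : ZMod p) = i + ((n + 1 + 1 : ℕ) : ZMod p) := by
      push_cast; ring
    rw [e] at c
    apply mul_left_cancel₀ (hnz (i + 1, n + 1))
    linear_combination (g (i, n + 2)) * c - b + a

/-- In a tube frieze with nonzero values over an integral domain, every value is the
generalised Chebyshev polynomial evaluated at the corresponding mouth values. -/
theorem tubeFrieze_eq_chebP {R : Type*} [CommRing R] [IsDomain R]
    (p : ℕ) (hp : 1 ≤ p) (g : ZMod p × ℕ → R)
    (hg : IsTubeFrieze p g) (hnz : ∀ x, g x ≠ 0) :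
    ∀ (i : ZMod p) (n : ℕ), 1 ≤ n →
      g (i, n) = chebP n (fun m => g (i + (m : ZMod p), 1)) := by
  intro i n _
  have key : ∀ n : ℕ, g (i, n) = chebP n (fun m => g (i + (m : ZMod p), 1)) ∧
      g (i, n + 1) = chebP (n + 1) (fun m => g (i + (m : ZMod p), 1)) := by
    intro n
    induction n with
    | zero => exact ⟨by simp [chebP, hg.1], by simp [chebP]⟩
    | succ n ih =>
      refine ⟨ih.2, ?_⟩
      have h := tubeFrieze_rec p g hg hnz n i
      rw [ih.1, ih.2] at h
      exact h
  exact (key n).1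
end

section
/- Let R be an integral domain and p ≥ 1 an integer. If g and g' are two R-friezes on the tube of rank p, all of whose values are nonzero, and g(i,1) = g'(i,1) for all i ∈ ℤ/pℤ, then g(i,n) = g'(i,n) for all i ∈ ℤ/pℤ and all n ∈ ℕ. (A frieze on a tube is entirely determined by its values on the mouth of the tube.) -/
/-- A frieze on a tube with nonzero values in an integral domain is entirely
determined by its values on the mouth of the tube. -/
theorem tubeFrieze_eq_of_eq_on_mouth {R : Type*} [CommRing R] [IsDomain R]
    (p : ℕ) (hp : 1 ≤ p) (g g' : ZMod p × ℕ → R)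
    (hg : IsTubeFrieze p g) (hg' : IsTubeFrieze p g')
    (hnz : ∀ x, g x ≠ 0) (hnz' : ∀ x, g' x ≠ 0)
    (hmouth : ∀ i : ZMod p, g (i, 1) = g' (i, 1)) :
    ∀ (i : ZMod p) (n : ℕ), g (i, n) = g' (i, n) := by
  have key : ∀ n : ℕ, (∀ i, g (i, n) = g' (i, n)) ∧ (∀ i, g (i, n + 1) = g' (i, n + 1)) := by
    intro n
    induction n with
    | zero => exact ⟨fun i => by rw [hg.1, hg'.1], hmouth⟩
    | succ n ih =>
      refine ⟨ih.2, fun i => ?_⟩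
      have h1 := hg.2 (i + 1) n
      have h2 := hg'.2 (i + 1) n
      rw [add_sub_cancel_right] at h1 h2
      rw [ih.2, ih.2, ih.1, h2] at h1
      exact (mul_left_cancel₀ (hnz' (i + 1, n)) (add_right_cancel h1)).symm
  exact fun i n => (key n).1 i
end

section
/- Let R be a commutative ring, p ≥ 1 an integer, and h : ℤ/pℤ → R any function. Define g : (ℤ/pℤ) × ℕ → R by g(i,0) = 1 and g(i,n) = P_n(h(i), h(i+1), …, h(i+n−1)) for n ≥ 1, where indices are taken in ℤ/pℤ. Then g is an R-frieze on the tube of rank p with mouth values g(i,1) = h(i). (Hence every function on the mouth of a tube can be completed into an R-frieze on the tube.) -/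
theorem chebP_mesh_aux {R : Type*} [CommRing R] (t : ℕ → R) (n : ℕ) :
    chebP (n + 1) (fun m => t (m + 1)) * chebP (n + 1) t =
      chebP n (fun m => t (m + 1)) * chebP (n + 2) t + 1 := by
  induction n with
  | zero => simp [chebP]
  | succ n ih =>
    have h1 : chebP (n + 1 + 1) (fun m => t (m + 1)) =
      t (n + 2) * chebP (n + 1) (fun m => t (m + 1)) - chebP n (fun m => t (m + 1)) := rfl
    have h2 : chebP (n + 1 + 2) t = t (n + 2) * chebP (n + 2) t - chebP (n + 1) t := rfl
    rw [h1, h2]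
    linear_combination ih

/-- Any function `h` on the mouth of a tube extends to an `R`-frieze on the tube,
namely `g(i,n) = P_n(h(i), h(i+1), …, h(i+n−1))` (note `g(i,0) = P_0 = 1`), and
the mouth values of this frieze are `g(i,1) = h(i)`. -/
theorem chebP_extension_isTubeFrieze {R : Type*} [CommRing R]
    (p : ℕ) (hp : 1 ≤ p) (h : ZMod p → R) :
    IsTubeFrieze p (fun x => chebP x.2 (fun m => h (x.1 + (m : ZMod p)))) ∧
      ∀ i : ZMod p, chebP 1 (fun m => h (i + (m : ZMod p))) = h i := by
  refine ⟨⟨fun i => rfl, fun i n => ?_⟩, fun i => by simp [chebP]⟩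
  have key := chebP_mesh_aux (fun m : ℕ => h (i - 1 + (m : ZMod p))) n
  have e : (fun m : ℕ => h (i - 1 + ((m + 1 : ℕ) : ZMod p))) =
      fun m : ℕ => h (i + (m : ZMod p)) := by
    funext m
    congr 1
    push_cast
    ring
  simp only [e] at key
  exact key
end

section
/- Let R be a commutative ring and x : ℕ → R any sequence. Then for every n ≥ 0, P_n(x_0, …, x_{n−1}) · P_n(x_1, …, x_n) = P_{n−1}(x_1, …, x_{n−1}) · P_{n+1}(x_0, …, x_n) + 1, where P_m denotes the m-th generalised Chebyshev polynomial (with the conventions P_{−1} = 0 and P_0 = 1). This is the mesh identity satisfied by the generalised Chebyshev polynomials which makes the Chebyshev extension of any mouth function into a frieze on a tube. -/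
/-- The mesh identity for generalised Chebyshev polynomials:
`P_n(x_0,…,x_{n−1}) · P_n(x_1,…,x_n) = P_{n−1}(x_1,…,x_{n−1}) · P_{n+1}(x_0,…,x_n) + 1`,
with the convention `P_{-1} = 0` (handled by the `if n = 0` clause). -/
theorem chebP_mesh_identity {R : Type*} [CommRing R] (x : ℕ → R) (n : ℕ) :
    chebP n x * chebP n (fun m => x (m + 1)) =
      (if n = 0 then 0 else chebP (n - 1) (fun m => x (m + 1))) * chebP (n + 1) x + 1 := by
  cases n with
  | zero => simp [chebP]
  | succ n =>
    simp only [Nat.add_eq_zero_iff, one_ne_zero, and_false, if_false, Nat.add_sub_cancel]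
    induction n with
    | zero => simp only [chebP]; ring
    | succ k ih =>
      have h1 : chebP (k + 1 + 1) (fun m => x (m + 1)) =
        x (k + 2) * chebP (k + 1) (fun m => x (m + 1)) - chebP k (fun m => x (m + 1)) := by
        rw [chebP]
      have h2 : chebP (k + 1 + 1 + 1) x =
        x (k + 2) * chebP (k + 1 + 1) x - chebP (k + 1) x := by
        rw [chebP]
      rw [h1, h2]
      linear_combination ih
end

section
/- Let Q be a finite acyclic quiver with vertex set V and arrow-multiplicity function E, and let f : ℤ × V → ℤ be a ℤ-frieze on the repetition quiver ℤQ such that f(0, i) = 1 for every i ∈ V. Then f(n, i) ≥ 1 for all n ∈ ℤ and i ∈ V. (This is the combinatorial content of the claim that the ℤ-frieze with value 1 on the initial section of the transjective component is everywhere positive, whence χ(Gr(M)) > 0 for every postprojective or preinjective module M.) -/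
theorem aux_wf_desc {V : Type*} [Finite V] (r : V → V → Prop)
    (h : ∀ (c : ℕ → V) (a b : ℕ), a < b → c a = c b → ∃ m, a ≤ m ∧ m < b ∧ ¬ r (c (m + 1)) (c m)) :
    WellFounded r := by
  rw [wellFounded_iff_isEmpty_descending_chain]
  refine ⟨fun ⟨c, hc⟩ => ?_⟩
  obtain ⟨x, y, hxy, he⟩ := Finite.exists_ne_map_eq_of_infinite c
  rcases lt_or_gt_of_ne hxy with hl | hl
  · obtain ⟨m, -, -, hm⟩ := h c x y hl he
    exact hm (hc m)
  · obtain ⟨m, -, -, hm⟩ := h c y x hl he.symm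
    exact hm (hc m)

theorem aux_prod {V : Type*} [Fintype V] (g : V → ℤ) (e : V → ℕ)
    (h : ∀ k, 0 < e k → 1 ≤ g k) : 0 < ∏ k, g k ^ e k := by
  refine Finset.prod_pos fun k _ => ?_
  rcases Nat.eq_zero_or_pos (e k) with h0 | h0
  · simp [h0]
  · have := h k h0
    positivity

/-- A `ℤ`-frieze on `ℤQ` with value `1` on the section `{0} × V` is everywhere
positive. -/
theorem int_frieze_pos_of_one_on_section {V : Type*} [Fintype V]
    (E : V → V → ℕ) (hac : IsAcyclic E)
    (f : ℤ × V → ℤ) (hf : IsFriezeZQ E f) (h1 : ∀ i : V, f (0, i) = 1) :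
    ∀ (n : ℤ) (i : V), 1 ≤ f (n, i) := by
  have wf1 : WellFounded (fun k i : V => 0 < E k i) := by
    refine aux_wf_desc _ fun c a b hab he => ?_
    obtain ⟨m, hm, h0⟩ := hac (b - a) (fun m => c (b - m)) (by omega)
      (by simp only [Nat.sub_zero]; rw [← he]; congr 1; omega)
    refine ⟨b - (m + 1), by omega, by omega, ?_⟩
    have : b - (m + 1) + 1 = b - m := by omega
    simp only [this]
    omega
  have wf2 : WellFounded (fun j i : V => 0 < E i j) := by
    refine aux_wf_desc _ fun c a b hab he => ?_
    obtain ⟨m, hm, h0⟩ := hac (b - a) (fun m => c (a + m)) (by omega)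
      (by simp only [Nat.add_zero]; rw [he]; congr 1; omega)
    exact ⟨a + m, by omega, by omega, by rw [add_assoc]; omega⟩
  have up : ∀ n : ℤ, (∀ i, 1 ≤ f (n - 1, i)) → ∀ i, 1 ≤ f (n, i) := by
    intro n h i
    induction i using wf1.induction with
    | _ i ih =>
      have e := hf n i
      have p1 := aux_prod (fun k => f (n, k)) (fun k => E k i) ih
      have p2 := aux_prod (fun k => f (n - 1, k)) (fun k => E i k) (fun k _ => h k)
      have p := mul_pos p1 p2
      have := h i
      have hp : 0 < f (n, i) * f (n - 1, i) := by rw [e]; linarith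
      exact (pos_iff_pos_of_mul_pos hp).2 (by linarith)
  have down : ∀ n : ℤ, (∀ i, 1 ≤ f (n, i)) → ∀ i, 1 ≤ f (n - 1, i) := by
    intro n h i
    induction i using wf2.induction with
    | _ i ih =>
      have e := hf n i
      have p1 := aux_prod (fun k => f (n, k)) (fun k => E k i) (fun k _ => h k)
      have p2 := aux_prod (fun k => f (n - 1, k)) (fun k => E i k) ih
      have p := mul_pos p1 p2
      have := h i
      have hp : 0 < f (n, i) * f (n - 1, i) := by rw [e]; linarith
      exact (pos_iff_pos_of_mul_pos hp).1 (by linarith)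
  intro n
  induction n using Int.induction_on with
  | zero => intro i; rw [h1]
  | succ n ih => exact up _ (by simpa using ih)
  | pred n ih => exact down _ ih
end

section
/- Let Q be a finite acyclic quiver with vertex set V and arrow-multiplicity function E. Then there is at most one ℤ-frieze f : ℤ × V → ℤ on the repetition quiver ℤQ with f(0, i) = 1 for all i ∈ V; that is, if f and g are two ℤ-friezes on ℤQ with f(0,i) = g(0,i) = 1 for all i ∈ V, then f = g. -/
theorem acyc_path {V : Type*} (E : V → V → ℕ) (a b : V)
    (h : Relation.TransGen (fun k i => 0 < E k i) a b) :
    ∃ (k : ℕ) (c : ℕ → V), 1 ≤ k ∧ c 0 = a ∧ c k = b ∧ ∀ m < k, 0 < E (c m) (c (m + 1)) := by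
  induction h with
  | @single b h =>
    refine ⟨1, fun m => if m = 0 then a else b, le_rfl, by simp, by simp, ?_⟩
    intro m hm
    obtain rfl : m = 0 := by omega
    simpa using h
  | @tail b d _ h ih =>
    obtain ⟨k, c, hk, h0, h1, h2⟩ := ih
    refine ⟨k + 1, fun m => if m ≤ k then c m else d, by omega, by simp [h0], by simp, ?_⟩
    intro m hm
    by_cases hmk : m = k
    · subst hmk
      simpa [h1] using h
    · have h3 : m < k := by omega
      have h4 : m + 1 ≤ k := h3
      simpa [h3.le, h4] using h2 m h3

theorem acyc_wf {V : Type*} [Finite V] (E : V → V → ℕ) (hac : IsAcyclic E) :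
    WellFounded (fun k i => 0 < E k i) := by
  have hi : Std.Irrefl (Relation.TransGen (fun k i => 0 < E k i)) := ⟨by
    intro a h
    obtain ⟨k, c, hk, h0, h1, h2⟩ := acyc_path E a a h
    obtain ⟨m, hm, h3⟩ := hac k c hk (h0.trans h1.symm)
    have := h2 m hm
    omega⟩
  have := Finite.wellFounded_of_trans_of_irrefl (Relation.TransGen (fun k i => 0 < E k i))
  exact Subrelation.wf (r := Relation.TransGen (fun k i => 0 < E k i)) (fun h => Relation.TransGen.single h) this

theorem acyc_swap {V : Type*} (E : V → V → ℕ) (hac : IsAcyclic E) :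
    IsAcyclic (fun i j => E j i) := by
  intro k c hk h
  obtain ⟨m, hm, h3⟩ := hac k (fun m => c (k - m)) hk (by simp [h])
  refine ⟨k - (m + 1), by omega, ?_⟩
  have : k - (m + 1) + 1 = k - m := by omega
  simpa [this] using h3

theorem frieze_step {V : Type*} [Fintype V] (E : V → V → ℕ) (hac : IsAcyclic E)
    (x y u : V → ℤ) (hu : ∀ i, 0 < u i)
    (hx : ∀ i, x i * u i = (∏ k, x k ^ E k i) * (∏ j, u j ^ E i j) + 1)
    (hy : ∀ i, y i * u i = (∏ k, y k ^ E k i) * (∏ j, u j ^ E i j) + 1) (i : V) :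
    0 < x i ∧ x i = y i := by
  induction i using (acyc_wf E hac).induction with
  | _ i ih =>
    have hp : (∏ k, x k ^ E k i) = ∏ k, y k ^ E k i := by
      refine Finset.prod_congr rfl fun k _ => ?_
      rcases Nat.eq_zero_or_pos (E k i) with h | h
      · simp [h]
      · rw [(ih k h).2]
    have hpos : 0 < ∏ k, x k ^ E k i := by
      refine Finset.prod_pos fun k _ => ?_
      rcases Nat.eq_zero_or_pos (E k i) with h | h
      · simp [h]
      · exact pow_pos (ih k h).1 _
    have hpos2 : 0 < ∏ j, u j ^ E i j := Finset.prod_pos fun j _ => pow_pos (hu j) _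
    constructor
    · have : 0 < x i * u i := by rw [hx i]; positivity
      exact pos_of_mul_pos_left this (hu i).le
    · apply mul_right_cancel₀ (hu i).ne'
      rw [hx i, hy i, hp]

/-- There is at most one `ℤ`-frieze on `ℤQ` taking the value `1` on the section
`{0} × V`. -/
theorem int_frieze_unique_of_one_on_section {V : Type*} [Fintype V]
    (E : V → V → ℕ) (hac : IsAcyclic E)
    (f g : ℤ × V → ℤ) (hf : IsFriezeZQ E f) (hg : IsFriezeZQ E g)
    (hf1 : ∀ i : V, f (0, i) = 1) (hg1 : ∀ i : V, g (0, i) = 1) :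
    f = g := by
  have key : ∀ n : ℤ, ∀ i, 0 < f (n, i) ∧ f (n, i) = g (n, i) := by
    intro n
    induction n using Int.induction_on with
    | zero => intro i; simp [hf1, hg1]
    | succ n ih =>
      refine frieze_step E hac (fun i => f (n + 1, i)) (fun i => g (n + 1, i))
        (fun i => f (n, i)) (fun i => (ih i).1) ?_ ?_
      · intro i
        simpa using hf (n + 1) i
      · intro i
        have := hg (n + 1) i
        simp only [add_sub_cancel_right] at this
        simp only [(ih _).2]
        exact this
    | pred n ih =>
      refine frieze_step _ (acyc_swap E hac) (fun i => f (-n - 1, i)) (fun i => g (-n - 1, i))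
        (fun i => f (-n, i)) (fun i => (ih i).1) ?_ ?_
      · intro i
        have := hf (-n) i
        rw [mul_comm, this, mul_comm]
      · intro i
        have := hg (-n) i
        simp only [(ih _).2]
        rw [mul_comm, this, mul_comm]
  funext ⟨n, i⟩
  exact (key n i).2
end
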